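/- Let A be a bounded residuated lattice. The following are equivalent: (1) for every a ∈ A there exists a Boolean element b ∈ A with b ∈ ⟨a⟩ and ¬b ∈ ⟨¬a⟩; (2) for every a ∈ A there exist a Boolean element b ∈ A and m, n > 0 such that aᵐ ≤ b ≤ n.a; (3) for every a ∈ A there exist a Boolean element b ∈ A and k > 0 such that aᵏ ≤ b ≤ k.a. -/

import Mathlib

universe u

/-- A bounded (integral, commutative) residuated lattice: a bounded lattice
with a commutative monoid operation `mul` (with unit `⊤`) and a residuum
`himp` satisfying the residuation condition. -/
class BRL (α : Type u) extends Lattice α, BoundedOrder α where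
  mul : α → α → α
  himp : α → α → α
  mul_comm : ∀ a b : α, mul a b = mul b a
  mul_assoc : ∀ a b c : α, mul (mul a b) c = mul a (mul b c)
  mul_top : ∀ a : α, mul a ⊤ = a
  residuation : ∀ a b c : α, mul a b ≤ c ↔ a ≤ himp b c

namespace BRL

variable {α : Type u} [BRL α]

/-- `¬a := a → ⊥`. -/
def neg (a : α) : α := himp a ⊥

/-- `a + b := ¬(¬a · ¬b)`. -/
def add (a b : α) : α := neg (mul (neg a) (neg b))

/-- Powers: `a⁰ = ⊤`, `aⁿ⁺¹ = a · aⁿ`. -/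
def pow (a : α) : ℕ → α
  | 0 => ⊤
  | n + 1 => mul a (pow a n)

/-- Multiples: `0.a = ⊥`, `(n+1).a = a + n.a`. -/
def nmul : ℕ → α → α
  | 0, _ => ⊥
  | n + 1, a => add a (nmul n a)

/-- Implicative filter. -/
def IsFilter (F : Set α) : Prop :=
  ⊤ ∈ F ∧ (∀ a b : α, a ∈ F → a ≤ b → b ∈ F) ∧
    (∀ a b : α, a ∈ F → b ∈ F → mul a b ∈ F)

/-- The smallest implicative filter containing `S`. -/
def genFilter (S : Set α) : Set α := ⋂₀ {F : Set α | IsFilter F ∧ S ⊆ F}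

/-- Maximal (proper) implicative filter. -/
def IsMaximal (M : Set α) : Prop :=
  IsFilter M ∧ M ≠ Set.univ ∧ ∀ G : Set α, IsFilter G → M ⊂ G → G = Set.univ

/-- Prime (proper) implicative filter. -/
def IsPrime (P : Set α) : Prop :=
  IsFilter P ∧ P ≠ Set.univ ∧ ∀ a b : α, a ⊔ b ∈ P → a ∈ P ∨ b ∈ P

/-- Minimal prime implicative filter (minimal among prime implicative filters). -/
def IsMinimalPrime (P : Set α) : Prop :=
  IsPrime P ∧ ∀ Q : Set α, IsPrime Q → Q ⊆ P → Q = P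

/-- The radical: intersection of all maximal implicative filters. -/
def Rad : Set α := {a : α | ∀ M : Set α, IsMaximal M → a ∈ M}

/-- Boolean (complemented) element. -/
def Boolean (b : α) : Prop := b ⊔ neg b = ⊤

/-- Stone ultrafilter: an implicative filter generated by an ultrafilter of
the Boolean algebra of Boolean elements. -/
def IsStoneUltra (F : Set α) : Prop :=
  IsFilter F ∧ F = genFilter (F ∩ {b : α | Boolean b}) ∧ (⊥ : α) ∉ F ∧
    ∀ b : α, Boolean b → b ∈ F ∨ neg b ∈ F

theorem mul_le_mul_right {a b : α} (h : a ≤ b) (c : α) : mul a c ≤ mul b c :=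
  (residuation a c _).2 (h.trans ((residuation b c _).1 le_rfl))

theorem mul_le_mul {a b c d : α} (h : a ≤ b) (h' : c ≤ d) : mul a c ≤ mul b d :=
  (mul_le_mul_right h c).trans (by
    rw [mul_comm b c, mul_comm b d]
    exact mul_le_mul_right h' b)

theorem mul_le_right (a b : α) : mul a b ≤ b := by
  have h := mul_le_mul_right (le_top : a ≤ ⊤) b
  rwa [mul_comm ⊤ b, mul_top] at h

theorem pow_antitone (a : α) : Antitone (pow a) :=
  antitone_nat_of_succ_le fun n => mul_le_right a (pow a n)

theorem pow_add (a : α) (m n : ℕ) : pow a (m + n) = mul (pow a m) (pow a n) := by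
  induction m with
  | zero => rw [Nat.zero_add, mul_comm]; exact (mul_top _).symm
  | succ m ih =>
    rw [Nat.succ_add]
    change mul a (pow a (m + n)) = mul (mul a (pow a m)) (pow a n)
    rw [ih, mul_assoc]

theorem pow_mem {F : Set α} (hF : IsFilter F) {a : α} (ha : a ∈ F) (n : ℕ) : pow a n ∈ F := by
  induction n with
  | zero => exact hF.1
  | succ n ih => exact hF.2.2 _ _ ha ih

theorem isFilter_setOf_pow_le (a : α) : IsFilter {b : α | ∃ n : ℕ, pow a n ≤ b} := by
  refine ⟨⟨0, le_top⟩, fun b c ⟨n, hn⟩ hbc => ⟨n, hn.trans hbc⟩, ?_⟩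
  rintro b c ⟨m, hm⟩ ⟨n, hn⟩
  exact ⟨m + n, (pow_add a m n).trans_le (mul_le_mul hm hn)⟩

theorem mem_genFilter_singleton {a b : α} :
    b ∈ genFilter {a} ↔ ∃ n : ℕ, 0 < n ∧ pow a n ≤ b := by
  constructor
  · intro h
    obtain ⟨n, hn⟩ := Set.mem_sInter.1 h _ ⟨isFilter_setOf_pow_le a,
      Set.singleton_subset_iff.2 ⟨1, (mul_top a).le⟩⟩
    exact ⟨n + 1, n.succ_pos, (pow_antitone a n.le_succ).trans hn⟩
  · rintro ⟨n, -, hn⟩ F ⟨hF, haF⟩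
    exact hF.2.1 _ _ (pow_mem hF (Set.singleton_subset_iff.1 haF) n) hn

theorem le_neg_iff_mul_le_bot {a b : α} : a ≤ neg b ↔ mul a b ≤ ⊥ :=
  (residuation a b ⊥).symm

theorem le_neg_comm {a b : α} : a ≤ neg b ↔ b ≤ neg a := by
  rw [le_neg_iff_mul_le_bot, le_neg_iff_mul_le_bot, mul_comm]

theorem le_neg_mul {a b c : α} : a ≤ neg (mul b c) ↔ mul a b ≤ neg c := by
  rw [le_neg_iff_mul_le_bot, le_neg_iff_mul_le_bot, mul_assoc]

theorem neg_antitone : Antitone (neg : α → α) := fun _ _ h =>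
  le_neg_comm.1 (h.trans (le_neg_comm.1 le_rfl))

theorem neg_neg_neg (a : α) : neg (neg (neg a)) = neg a :=
  le_antisymm (neg_antitone (le_neg_comm.1 le_rfl)) (le_neg_comm.1 le_rfl)

theorem nmul_eq_neg_pow (a : α) (n : ℕ) : nmul n a = neg (pow (neg a) n) := by
  refine eq_of_forall_le_iff fun b => ?_
  induction n generalizing b with
  | zero =>
    rw [le_neg_iff_mul_le_bot]
    change b ≤ ⊥ ↔ mul b ⊤ ≤ ⊥
    rw [mul_top]
  | succ n ih =>
    change b ≤ neg (mul (neg a) (neg (nmul n a))) ↔ b ≤ neg (mul (neg a) (pow (neg a) n))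
    rw [eq_of_forall_le_iff ih, le_neg_mul, le_neg_mul, neg_neg_neg]

theorem le_nmul_iff {a b : α} {n : ℕ} : b ≤ nmul n a ↔ pow (neg a) n ≤ neg b := by
  rw [nmul_eq_neg_pow, le_neg_comm]

theorem nmul_monotone (a : α) : Monotone fun n => nmul n a := fun _ _ h =>
  le_nmul_iff.2 ((pow_antitone _ h).trans (le_nmul_iff.1 le_rfl))

theorem gap_tfae :
    ((∀ a : α, ∃ b : α, Boolean b ∧ b ∈ genFilter {a} ∧ neg b ∈ genFilter {neg a}) ↔
      (∀ a : α, ∃ b : α, Boolean b ∧ ∃ m n : ℕ, 0 < m ∧ 0 < n ∧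
        pow a m ≤ b ∧ b ≤ nmul n a)) ∧
    ((∀ a : α, ∃ b : α, Boolean b ∧ ∃ m n : ℕ, 0 < m ∧ 0 < n ∧
        pow a m ≤ b ∧ b ≤ nmul n a) ↔
      (∀ a : α, ∃ b : α, Boolean b ∧ ∃ k : ℕ, 0 < k ∧
        pow a k ≤ b ∧ b ≤ nmul k a)) := by
  constructor
  · refine forall_congr' fun a => exists_congr fun b => and_congr_right fun _ => ?_
    simp only [mem_genFilter_singleton, le_nmul_iff]
    constructor
    · rintro ⟨⟨m, hm, hmb⟩, n, hn, hnb⟩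
      exact ⟨m, n, hm, hn, hmb, hnb⟩
    · rintro ⟨m, n, hm, hn, hmb, hnb⟩
      exact ⟨⟨m, hm, hmb⟩, n, hn, hnb⟩
  · refine forall_congr' fun a => exists_congr fun b => and_congr_right fun _ => ?_
    constructor
    · rintro ⟨m, n, hm, -, hmb, hbn⟩
      exact ⟨max m n, lt_max_of_lt_left hm, (pow_antitone a (le_max_left m n)).trans hmb,
        hbn.trans (nmul_monotone a (le_max_right m n))⟩
    · rintro ⟨k, hk, hkb, hbk⟩
      exact ⟨k, k, hk, hk, hkb, hbk⟩

end BRL
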